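/- If U is a rapid p-point ultrafilter on ω, then U·U ≡_T U. -/

import Mathlib

open Set

/-- A subset `S` is bounded with respect to the relation `r`. -/
def RelBounded {α : Type*} (r : α → α → Prop) (S : Set α) : Prop :=
  ∃ b, ∀ a ∈ S, r a b

/-- Tukey reducibility between two ordered sets: there is a map sending every
unbounded set to an unbounded set. -/
def TukeyLE {α β : Type*} (ra : α → α → Prop) (rb : β → β → Prop) : Prop :=
  ∃ f : α → β, ∀ S : Set α, ¬ RelBounded ra S → ¬ RelBounded rb (f '' S)

/-- Tukey equivalence. -/
def TukeyEquiv {α β : Type*} (ra : α → α → Prop) (rb : β → β → Prop) : Prop :=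
  TukeyLE ra rb ∧ TukeyLE rb ra

/-- `S` is cofinal with respect to the relation `r`. -/
def IsCofinalIn {α : Type*} (r : α → α → Prop) (S : Set α) : Prop :=
  ∀ a, ∃ b ∈ S, r a b

/-- The poset `(U, ⊇)` associated to a filter `U`: `A ≤ B` iff `A ⊇ B`. -/
def filtRel {X : Type*} (U : Filter X) :
    {A : Set X // A ∈ U} → {A : Set X // A ∈ U} → Prop :=
  fun A B => B.1 ⊆ A.1

/-- The poset `(I, ⊆)` associated to a family of sets `I`. -/
def subRel {X : Type*} (I : Set (Set X)) :
    {A : Set X // A ∈ I} → {A : Set X // A ∈ I} → Prop :=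
  fun A B => A.1 ⊆ B.1

/-- The Fubini product of filters: `A ∈ U·V` iff `{x | (A)_x ∈ V} ∈ U`,
where `(A)_x = {y | (x, y) ∈ A}`. -/
def fubini {X Y : Type*} (U : Filter X) (V : Filter Y) : Filter (X × Y) :=
  U.bind fun x => V.map (Prod.mk x)

/-- The ω-fold power of an ordered set, with the everywhere (pointwise)
domination order. -/
def seqRel {α : Type*} (r : α → α → Prop) : (ℕ → α) → (ℕ → α) → Prop :=
  fun f g => ∀ n, r (f n) (g n)

/-- The product order on a Cartesian product of two ordered sets. -/
def prodRel {α β : Type*} (ra : α → α → Prop) (rb : β → β → Prop) :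
    α × β → α × β → Prop :=
  fun p q => ra p.1 q.1 ∧ rb p.2 q.2

/-- The everywhere domination order on `ω^ω`. -/
def domRel : (ℕ → ℕ) → (ℕ → ℕ) → Prop := fun f g => ∀ n, f n ≤ g n

/-- An ideal on `X`: a family of subsets containing `∅`, closed under subsets
and finite unions. -/
def IsIdeal {X : Type*} (I : Set (Set X)) : Prop :=
  ∅ ∈ I ∧ (∀ A ∈ I, ∀ B ⊆ A, B ∈ I) ∧ (∀ A ∈ I, ∀ B ∈ I, A ∪ B ∈ I)

/-- `U` has the `I`-pseudo-intersection property: every ω-sequence of members of `U`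
has a pseudo-intersection modulo `I` in `U`. -/
def HasPIP {X : Type*} (U : Filter X) (I : Set (Set X)) : Prop :=
  ∀ A : ℕ → Set X, (∀ n, A n ∈ U) → ∃ B ∈ U, ∀ n, B \ A n ∈ I

/-- A p-point: a nonprincipal ultrafilter on `ω` which has the fin-pseudo-intersection
property. -/
def IsPPoint (U : Ultrafilter ℕ) : Prop :=
  (∀ a : ℕ, (U : Filter ℕ) ≠ pure a) ∧
  ∀ A : ℕ → Set ℕ, (∀ n, A n ∈ U) → ∃ B ∈ U, ∀ n, (B \ A n).Finite

/-- A rapid ultrafilter: a nonprincipal ultrafilter `U` on `ω` such that for every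
increasing `f : ω → ω` there is `X ∈ U` with `|X ∩ f(n)| ≤ n` for all `n`. -/
def IsRapid (U : Ultrafilter ℕ) : Prop :=
  (∀ a : ℕ, (U : Filter ℕ) ≠ pure a) ∧
  ∀ f : ℕ → ℕ, StrictMono f → ∃ X ∈ U, ∀ n, (X ∩ Set.Iio (f n)).ncard ≤ n

/-- The ideal `fin ⊗ fin` on `ω × ω`: all sets with only finitely many infinite
vertical sections. -/
def finOtimesFin : Set (Set (ℕ × ℕ)) :=
  {A | {n : ℕ | {m : ℕ | (n, m) ∈ A}.Infinite}.Finite}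

theorem mem_fubini {X Y : Type*} {U : Filter X} {V : Filter Y} {A : Set (X × Y)} :
    A ∈ fubini U V ↔ {x | {y | (x, y) ∈ A} ∈ V} ∈ U :=
  Iff.rfl

/-- A map pulling bounded sets back to bounded sets witnesses Tukey reducibility. -/
theorem TukeyLE.of_bounds {α β : Type*} {ra : α → α → Prop} {rb : β → β → Prop} (f : α → β)
    (h : ∀ b, ∃ c, ∀ a, rb (f a) b → ra a c) : TukeyLE ra rb := by
  refine ⟨f, fun S hS => fun ⟨b, hb⟩ => hS ?_⟩
  obtain ⟨c, hc⟩ := h b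
  exact ⟨c, fun a ha => hc a (hb _ (mem_image_of_mem f ha))⟩

theorem tukeyLE_fubini {X Y : Type*} (U : Filter X) (V : Filter Y) [V.NeBot] :
    TukeyLE (filtRel U) (filtRel (fubini U V)) := by
  refine TukeyLE.of_bounds (fun A => ⟨Prod.fst ⁻¹' A.1, ?_⟩) fun B => ⟨⟨Prod.fst '' B.1, ?_⟩, ?_⟩
  · refine mem_fubini.2 (Filter.mem_of_superset A.2 fun x hx => ?_)
    exact Filter.mem_of_superset Filter.univ_mem fun _ _ => hx
  · refine Filter.mem_of_superset (mem_fubini.1 B.2) fun x hx => ?_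
    obtain ⟨y, hy⟩ := Filter.nonempty_of_mem hx
    exact ⟨(x, y), hy, rfl⟩
  · exact fun A hA => image_subset_iff.2 hA

theorem Ultrafilter.le_cofinite_of_ne_pure {X : Type*} {U : Ultrafilter X}
    (h : ∀ a, (U : Filter X) ≠ pure a) : (U : Filter X) ≤ Filter.cofinite := by
  rcases U.le_cofinite_or_eq_pure with h' | ⟨a, ha⟩
  · exact h'
  · exact absurd (congrArg (fun V : Ultrafilter X => (V : Filter X)) ha) (h a)

/-- A strictly increasing function that dominates `h` everywhere. -/
theorem exists_strictMono_ge (h : ℕ → ℕ) : ∃ g : ℕ → ℕ, StrictMono g ∧ ∀ n, h n ≤ g n := by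
  refine ⟨fun n => ∑ i ∈ Finset.range (n + 1), (h i + 1), strictMono_nat_of_lt_succ fun n => ?_,
    fun n => ?_⟩
  · rw [Finset.sum_range_succ _ (n + 1)]
    omega
  · simp only [Finset.sum_range_succ _ n]
    omega

/-- Beyond some point, an infinite set of naturals has more than `n` elements below. -/
theorem Set.Infinite.finite_ncard_inter_Iio_le {D : Set ℕ} (hD : D.Infinite) (n : ℕ) :
    {y | (D ∩ Iio y).ncard ≤ n}.Finite := by
  obtain ⟨t, htD, ht⟩ := hD.exists_subset_card_eq (n + 1)
  refine (finite_Iic (t.sup id)).subset fun y hy => ?_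
  by_contra hlt
  have hsub : (t : Set ℕ) ⊆ D ∩ Iio y := fun a ha =>
    ⟨htD ha, lt_of_le_of_lt (Finset.le_sup (f := id) ha) (not_le.1 hlt)⟩
  have hcard := ncard_le_ncard hsub ((finite_Iio y).inter_of_right D)
  rw [ncard_coe_finset, ht] at hcard
  exact absurd (hcard.trans hy) (by omega)

/-- The set `A` contains a rectangle over a member of `U` whose vertical sections are cut off
by the growth of that member. -/
theorem exists_mem_forall_subset_of_mem_fubini {U : Ultrafilter ℕ} (hp : IsPPoint U)
    (hr : IsRapid U) {A : Set (ℕ × ℕ)} (hA : A ∈ fubini (U : Filter ℕ) (U : Filter ℕ)) :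
    ∃ E ∈ (U : Filter ℕ), ∀ D ⊆ E,
      {p : ℕ × ℕ | p.1 ∈ D ∧ p.2 ∈ D ∧ p.1 < (D ∩ Iio p.2).ncard} ⊆ A := by
  have hA' := mem_fubini.1 hA
  set A' := {x | {y | (x, y) ∈ A} ∈ (U : Filter ℕ)}
  obtain ⟨B, hB, hBfin⟩ := hp.2 (fun x => {y | x ∈ A' → (x, y) ∈ A}) fun x => by
    by_cases hx : x ∈ A'
    · exact Filter.mem_of_superset (show {y | (x, y) ∈ A} ∈ (U : Filter ℕ) from hx)
        fun y hy _ => hy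
    · exact Filter.mem_of_superset Filter.univ_mem fun y _ hx' => absurd hx' hx
  choose h hh using fun x => (hBfin x).bddAbove
  obtain ⟨g, hg, hhg⟩ := exists_strictMono_ge h
  obtain ⟨X, hX, hXg⟩ := hr.2 g hg
  refine ⟨A' ∩ B ∩ X, Filter.inter_mem (Filter.inter_mem hA' hB) hX, ?_⟩
  rintro D hD ⟨x, y⟩ ⟨hx, hy, hxy⟩
  have hgy : g x < y := by
    by_contra hle
    have hsub : D ∩ Iio y ⊆ X ∩ Iio (g x) := fun a ha =>
      ⟨(hD ha.1).2, lt_of_lt_of_le ha.2 (not_lt.1 hle)⟩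
    have hcard := ncard_le_ncard hsub ((finite_Iio (g x)).inter_of_right X)
    exact absurd (hcard.trans (hXg x)) (not_le.2 hxy)
  by_contra hyA
  have hyh : y ≤ h x := hh x ⟨(hD hy).1.2, fun hmem => hyA (hmem (hD hx).1.1)⟩
  exact absurd (hyh.trans (hhg x)) (not_le.2 hgy)

theorem fubini_tukeyLE {U : Ultrafilter ℕ} (hp : IsPPoint U) (hr : IsRapid U) :
    TukeyLE (filtRel (fubini (U : Filter ℕ) (U : Filter ℕ))) (filtRel (U : Filter ℕ)) := by
  have hcof := Ultrafilter.le_cofinite_of_ne_pure hp.1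
  choose f hfU hf using fun A : {A // A ∈ fubini (U : Filter ℕ) (U : Filter ℕ)} =>
    exists_mem_forall_subset_of_mem_fubini hp hr A.2
  refine TukeyLE.of_bounds (fun A => ⟨f A, hfU A⟩) fun D =>
    ⟨⟨{p | p.1 ∈ D.1 ∧ p.2 ∈ D.1 ∧ p.1 < (D.1 ∩ Iio p.2).ncard}, ?_⟩, fun A hA => hf A D.1 hA⟩
  have hinf : D.1.Infinite := fun hfin =>
    Filter.compl_notMem D.2 (hcof hfin.compl_mem_cofinite)
  refine mem_fubini.2 (Filter.mem_of_superset D.2 fun x hx => ?_)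
  filter_upwards [D.2, hcof (hinf.finite_ncard_inter_Iio_le x).compl_mem_cofinite] with y hy hxy
  exact ⟨hx, hy, not_le.1 hxy⟩

/-- If `U` is a rapid p-point on `ω`, then `U·U ≡_T U`. -/
theorem stmt9 (U : Ultrafilter ℕ) (hp : IsPPoint U) (hr : IsRapid U) :
    TukeyEquiv (filtRel (fubini (U : Filter ℕ) (U : Filter ℕ)))
      (filtRel (U : Filter ℕ)) := by
  exact ⟨fubini_tukeyLE hp hr, tukeyLE_fubini _ _⟩
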